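/- arXiv:2207.01712 — 7 statements merged into one kernel-verified Lean document; each statement's English description precedes it below -/
import Mathlib

section
/- (Jucys' lemma, Lemma 4.1) Assume h ≠ 0, and for an integer k ≥ 1 set u_i = u + (i−1)h for i = 1,…,k (where u ∈ K is arbitrary). Then on V^{⊗k} one has ∏_{1 ≤ i < j ≤ k} R̄_{ij}(u_i − u_j) = k! · A_k, where the product is taken in the lexicographical order on the pairs (i,j). Equivalently, ∏_{1 ≤ i < j ≤ k} (id + (1/(i−j))·P_{ij}) = Σ_{σ ∈ S_k} sgn(σ)·P_σ. -/
noncomputable section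

variable (K : Type*) [Field K]

/-- The flip operator `P` on `V ⊗ V`, `V = K^n`, as a matrix. -/
def flipP (n : ℕ) : Matrix (Fin 2 → Fin n) (Fin 2 → Fin n) K :=
  Matrix.of fun a b => if a 0 = b 1 ∧ a 1 = b 0 then 1 else 0

/-- Yang's R-matrix `R̄(x) = id + (h/x)·P`. -/
def Rbar (n : ℕ) (h x : K) : Matrix (Fin 2 → Fin n) (Fin 2 → Fin n) K :=
  1 + (h / x) • flipP K n

/-- The operator `X_{ij}` on `V^{⊗ m}`: `X` acting in the `i`-th and `j`-th tensor
factors and the identity elsewhere. -/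
def liftOp {m n : ℕ} (i j : Fin m) (X : Matrix (Fin 2 → Fin n) (Fin 2 → Fin n) K) :
    Matrix (Fin m → Fin n) (Fin m → Fin n) K :=
  Matrix.of fun a b =>
    X ![a i, a j] ![b i, b j] *
      ∏ k ∈ Finset.univ.filter (fun k => k ≠ i ∧ k ≠ j), (if a k = b k then (1 : K) else 0)

/-- The operator `P_σ` permuting the tensor factors of `V^{⊗ k}` according to `σ`. -/
def permOp {k n : ℕ} (σ : Equiv.Perm (Fin k)) : Matrix (Fin k → Fin n) (Fin k → Fin n) K :=
  Matrix.of fun a b => if a = b ∘ σ then 1 else 0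

/-- The antisymmetrizer `A_k = (1/k!) Σ_σ sgn(σ) P_σ` on `V^{⊗ k}`. -/
def antisym (k n : ℕ) : Matrix (Fin k → Fin n) (Fin k → Fin n) K :=
  ((k.factorial : K)⁻¹) •
    ∑ σ : Equiv.Perm (Fin k), (((Equiv.Perm.sign σ : ℤ) : K)) • permOp K σ

/-- The embedding of `Perm (Fin k)` into `Perm (Fin (k + 1))` as the stabilizer of `0`. -/
def permSuccHom (k : ℕ) : Equiv.Perm (Fin k) →* Equiv.Perm (Fin (k + 1)) where
  toFun e := Equiv.Perm.decomposeFin.symm (0, e)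
  map_one' := (Equiv.Perm.decomposeFin_symm_of_one 0).trans (Equiv.swap_self 0)
  map_mul' e f := by
    ext x
    refine Fin.cases ?_ (fun i => ?_) x <;> simp

theorem permSuccHom_apply_zero {k : ℕ} (e : Equiv.Perm (Fin k)) : permSuccHom k e 0 = 0 := by
  simp [permSuccHom]

theorem permSuccHom_apply_succ {k : ℕ} (e : Equiv.Perm (Fin k)) (i : Fin k) :
    permSuccHom k e i.succ = (e i).succ := by
  simp [permSuccHom]

theorem permSuccHom_swap {k : ℕ} (i j : Fin k) :
    permSuccHom k (Equiv.swap i j) = Equiv.swap i.succ j.succ := by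
  ext1 x
  refine Fin.cases ?_ (fun l => ?_) x
  · rw [permSuccHom_apply_zero,
      Equiv.swap_apply_of_ne_of_ne (Fin.succ_ne_zero i).symm (Fin.succ_ne_zero j).symm]
  · rw [permSuccHom_apply_succ, (Fin.succ_injective k).swap_apply]

theorem decomposeFin_symm_eq_swap_mul {k : ℕ} (p : Fin (k + 1)) (e : Equiv.Perm (Fin k)) :
    Equiv.Perm.decomposeFin.symm (p, e) = Equiv.swap 0 p * permSuccHom k e := by
  ext1 x
  refine Fin.cases ?_ (fun l => ?_) x
  · simp [permSuccHom_apply_zero]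
  · simp [permSuccHom_apply_succ]

theorem sign_permSuccHom {k : ℕ} (e : Equiv.Perm (Fin k)) :
    Equiv.Perm.sign (permSuccHom k e) = Equiv.Perm.sign e := by
  simp [permSuccHom]

/-- The image under `ρ` of the signed sum of all permutations. -/
def signedSum {A : Type*} [Ring A] {k : ℕ} (ρ : Equiv.Perm (Fin k) →* A) : A :=
  ∑ σ, ((Equiv.Perm.sign σ : ℤ) : A) * ρ σ

theorem map_swap_mul_signedSum {A : Type*} [Ring A] {k : ℕ} (ρ : Equiv.Perm (Fin k) →* A)
    {i j : Fin k} (hij : i ≠ j) :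
    ρ (Equiv.swap i j) * signedSum ρ = -signedSum ρ := by
  rw [signedSum, Finset.mul_sum, ← Finset.sum_neg_distrib]
  refine Fintype.sum_equiv (Equiv.mulLeft (Equiv.swap i j)) _ _ fun σ => ?_
  rw [Equiv.coe_mulLeft, Equiv.Perm.sign_mul, Equiv.Perm.sign_swap hij, map_mul,
    ← mul_assoc, ← (Int.cast_commute _ _).eq]
  simp [mul_assoc]

theorem signedSum_succ {A : Type*} [Ring A] {k : ℕ} (ρ : Equiv.Perm (Fin (k + 1)) →* A) :
    signedSum ρ = signedSum (ρ.comp (permSuccHom k)) -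
      (∑ j : Fin k, ρ (Equiv.swap 0 j.succ)) * signedSum (ρ.comp (permSuccHom k)) := by
  have key : signedSum ρ = ∑ p : Fin (k + 1), ∑ e : Equiv.Perm (Fin k),
      ((Equiv.Perm.sign (Equiv.swap 0 p * permSuccHom k e) : ℤ) : A) *
        ρ (Equiv.swap 0 p * permSuccHom k e) := by
    rw [signedSum, ← Fintype.sum_prod_type']
    exact (Fintype.sum_equiv Equiv.Perm.decomposeFin.symm _ _ fun x => by
      rw [← decomposeFin_symm_eq_swap_mul]).symm
  rw [key, Fin.sum_univ_succ, sub_eq_add_neg, ← neg_mul, ← Finset.sum_neg_distrib,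
    Finset.sum_mul]
  congr 1
  · simp [signedSum, sign_permSuccHom, ← Equiv.Perm.one_def]
  · refine Finset.sum_congr rfl fun j _ => ?_
    rw [signedSum, Finset.mul_sum]
    refine Finset.sum_congr rfl fun e _ => ?_
    rw [Equiv.Perm.sign_mul, Equiv.Perm.sign_swap (Fin.succ_ne_zero j).symm, sign_permSuccHom,
      map_mul, MonoidHom.comp_apply, ← mul_assoc (-ρ _), ← (Int.cast_commute _ _).eq]
    simp [mul_assoc]

theorem prod_one_sub_smul_mul {F A : Type*} [Field F] [CharZero F] [Ring A] [Algebra F A] (B : A)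
    (l : ℕ) (x : Fin l → A) (hx : ∀ i j, i < j → x i * (x j * B) = -(x j * B)) (c : ℕ)
    (hc : c ≠ 0) :
    ((List.finRange l).map fun j : Fin l => 1 - (((c + (j : ℕ) : ℕ) : F)⁻¹) • x j).prod * B =
      B - ((c : F)⁻¹) • ((∑ j, x j) * B) := by
  induction l generalizing c with
  | zero => simp
  | succ l ih =>
    have h1 := ih (fun j => x j.succ) (fun i j hij => hx _ _ (Fin.succ_lt_succ_iff.2 hij))
      (c + 1) c.succ_ne_zero
    have h2 : x 0 * ((∑ j : Fin l, x j.succ) * B) = -((∑ j : Fin l, x j.succ) * B) := by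
      rw [Finset.sum_mul, Finset.mul_sum, ← Finset.sum_neg_distrib]
      exact Finset.sum_congr rfl fun j _ => hx _ _ (Fin.succ_pos j)
    have h3 : ∀ j : Fin l, c + ((j.succ : Fin (l + 1)) : ℕ) = c + 1 + (j : ℕ) := fun j => by
      simp; ring
    rw [List.finRange_succ, List.map_cons, List.prod_cons, List.map_map, mul_assoc]
    simp only [Function.comp_def, h3]
    rw [h1, Fin.sum_univ_succ]
    have hc' : (c : F) ≠ 0 := Nat.cast_ne_zero.2 hc
    have hc1 : (c : F) + 1 ≠ 0 := Nat.cast_add_one_ne_zero c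
    simp only [Fin.val_zero, add_zero, sub_mul, one_mul, mul_sub, add_mul, smul_mul_assoc,
      mul_smul_comm, h2, Nat.cast_add, Nat.cast_one]
    match_scalars <;> field_simp
    ring

/-- Jucys' factorization of the signed sum of all permutations. -/
theorem prod_prod_one_sub_smul_swap {F A : Type*} [Field F] [CharZero F] [Ring A] [Algebra F A]
    (k : ℕ) (ρ : Equiv.Perm (Fin k) →* A) :
    ((List.finRange k).map fun i : Fin k =>
      (((List.finRange k).filter (fun j => decide (i < j))).map fun j : Fin k =>
        1 - ((((j : ℕ) : F) - ((i : ℕ) : F))⁻¹) • ρ (Equiv.swap i j)).prod).prod =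
      signedSum ρ := by
  induction k with
  | zero => simp [signedSum]
  | succ k ih =>
    have h1 := ih (ρ.comp (permSuccHom k))
    have h2 := prod_one_sub_smul_mul (F := F) (signedSum (ρ.comp (permSuccHom k))) k
      (fun j => ρ (Equiv.swap 0 j.succ)) (fun i j hij => by
        have h3 : (Equiv.swap 0 i.succ : Equiv.Perm (Fin (k + 1))) * Equiv.swap 0 j.succ =
            Equiv.swap 0 j.succ * permSuccHom k (Equiv.swap i j) := by
          rw [permSuccHom_swap, Equiv.mul_swap_eq_swap_mul _ i.succ, Equiv.swap_apply_right,
            Equiv.swap_apply_of_ne_of_ne (Fin.succ_ne_zero i)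
              ((Fin.succ_injective k).ne hij.ne), Equiv.swap_comm 0 i.succ]
        have h4 := map_swap_mul_signedSum (ρ.comp (permSuccHom k)) hij.ne
        rw [MonoidHom.comp_apply] at h4
        rw [← mul_assoc, ← map_mul, h3, map_mul, mul_assoc, h4, mul_neg]) 1 one_ne_zero
    rw [signedSum_succ, ← h1]
    rw [← h1] at h2
    simp only [Nat.cast_one, inv_one, one_smul] at h2
    rw [← h2]
    simp [List.finRange_succ, List.filter_map, Function.comp_def, permSuccHom_swap, add_comm]

theorem permOp_mul {k n : ℕ} (σ τ : Equiv.Perm (Fin k)) :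
    permOp (n := n) K σ * permOp K τ = permOp K (τ * σ) := by
  ext a c
  simp only [permOp, Matrix.mul_apply, Matrix.of_apply, mul_ite, mul_one, mul_zero,
    Finset.sum_ite_eq', Finset.mem_univ, if_true, Equiv.Perm.coe_mul, ← Function.comp_assoc]
  congr

/-- The representation of the symmetric group permuting the tensor factors. -/
def permOpHom (k n : ℕ) : Equiv.Perm (Fin k) →* Matrix (Fin k → Fin n) (Fin k → Fin n) K where
  toFun σ := permOp K σ⁻¹
  map_one' := by ext a b; simp [permOp, Matrix.one_apply]
  map_mul' σ τ := by rw [permOp_mul, mul_inv_rev]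

theorem liftOp_one_add_smul_flipP {m n : ℕ} (i j : Fin m) (c : K) :
    liftOp K i j (1 + c • flipP K n) = 1 + c • permOp K (Equiv.swap i j) := by
  have h1 : ∀ a b : Fin m → Fin n,
      (∏ k ∈ Finset.univ.filter (fun k => k ≠ i ∧ k ≠ j), (if a k = b k then (1 : K) else 0)) =
        if ∀ k, k ≠ i ∧ k ≠ j → a k = b k then 1 else 0 := fun a b => by
    rw [Finset.prod_ite_zero]
    simp
  have h2 : ∀ a b : Fin m → Fin n, a = b ↔
      (a i = b i ∧ a j = b j) ∧ ∀ k, k ≠ i ∧ k ≠ j → a k = b k := fun a b => by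
    rw [funext_iff]
    grind
  have h3 : ∀ a b : Fin m → Fin n, a = b ∘ Equiv.swap i j ↔
      (a i = b j ∧ a j = b i) ∧ ∀ k, k ≠ i ∧ k ≠ j → a k = b k := fun a b => by
    rw [h2]
    simp only [Function.comp_apply, Equiv.swap_apply_left, Equiv.swap_apply_right]
    refine and_congr_right fun _ => forall₂_congr fun k hk => ?_
    rw [Equiv.swap_apply_of_ne_of_ne hk.1 hk.2]
  ext a b
  simp only [liftOp, permOp, flipP, Matrix.of_apply, Matrix.add_apply, Matrix.smul_apply,
    Matrix.one_apply, h1, h3]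
  simp only [h2 a b]
  by_cases h4 : ∀ k, k ≠ i ∧ k ≠ j → a k = b k
  · simp only [eq_true h4, and_true, if_true, mul_one]
    simp [funext_iff, Fin.forall_fin_two]
  · simp only [eq_false h4, and_false, if_false, mul_zero, smul_zero, add_zero]

/-- Jucys' lemma: with `u_i = u + (i−1)h`,
`∏_{1 ≤ i < j ≤ k} R̄_{ij}(u_i − u_j) = k! · A_k`, the product taken in lexicographical
order on the pairs `(i, j)`. -/
theorem stmt2 (n : ℕ) (hn : 1 ≤ n) [CharZero K] (h : K) (hh : h ≠ 0) (k : ℕ) (hk : 1 ≤ k)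
    (u : K) :
    ((List.finRange k).flatMap (fun i =>
        ((List.finRange k).filter (fun j => decide (i < j))).map (fun j =>
          liftOp K i j
            (Rbar K n h ((u + (i : ℕ) * h) - (u + (j : ℕ) * h)))))).prod
      = (k.factorial : K) • antisym K k n := by
  have hR : ∀ i j : Fin k, i < j →
      liftOp K i j (Rbar K n h ((u + (i : ℕ) * h) - (u + (j : ℕ) * h))) =
        1 - ((((j : ℕ) : K) - ((i : ℕ) : K))⁻¹) • permOpHom K k n (Equiv.swap i j) := by
    intro i j hij
    have h1 : ((j : ℕ) : K) - ((i : ℕ) : K) ≠ 0 :=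
      sub_ne_zero.2 (Nat.cast_injective.ne (Fin.val_injective.ne hij.ne'))
    have h2 : h / ((u + (i : ℕ) * h) - (u + (j : ℕ) * h)) =
        -(((j : ℕ) : K) - ((i : ℕ) : K))⁻¹ := by
      rw [show (u + (i : ℕ) * h) - (u + (j : ℕ) * h) =
        -((((j : ℕ) : K) - ((i : ℕ) : K)) * h) by ring]
      field_simp
    rw [Rbar, h2, liftOp_one_add_smul_flipP, neg_smul, ← sub_eq_add_neg]
    simp [permOpHom]
  have hk0 : (k.factorial : K) ≠ 0 := Nat.cast_ne_zero.2 k.factorial_ne_zero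
  rw [antisym, smul_inv_smul₀ hk0, List.flatMap_def, List.prod_flatten, List.map_map]
  refine Eq.trans ?_ ((prod_prod_one_sub_smul_swap (F := K) k (permOpHom K k n)).trans ?_)
  · refine congrArg List.prod (List.map_congr_left fun i _ => congrArg List.prod
      (List.map_congr_left fun j hj => hR i j ?_))
    simpa using hj
  · refine Fintype.sum_equiv (Equiv.inv _) _ _ fun σ => ?_
    rw [← zsmul_eq_mul, Int.cast_smul_eq_zsmul]
    simp [permOpHom]
end
end

section
/- (Crossing symmetry, Lemma 4.3) Let u ∈ K with u ≠ 0, u² ≠ h², and u ≠ nh, and let φ, ψ ∈ K be nonzero scalars satisfying ψ = ((u² − h²)/u²)·φ (modeling the values ψ = f(u − nh) and φ = f(u) of the normalizing series f with f(u−nh) = ((u²−h²)/u²)f(u)). Set R(u) := φ·R̄(u) and R(u−nh) := ψ·R̄(u−nh). Then R(u) is invertible and the crossing symmetry relations hold: (R(u)^{-1})^{t_2} · (R(u−nh))^{t_2} = id and (R(u−nh))^{t_1} · (R(u)^{-1})^{t_1} = id on V ⊗ V. -/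
noncomputable section

variable (K : Type*) [Field K]

/-- Partial transpose in the first tensor factor. -/
def pt1 {n : ℕ} (X : Matrix (Fin 2 → Fin n) (Fin 2 → Fin n) K) :
    Matrix (Fin 2 → Fin n) (Fin 2 → Fin n) K :=
  Matrix.of fun a b => X ![b 0, a 1] ![a 0, b 1]

/-- Partial transpose in the second tensor factor. -/
def pt2 {n : ℕ} (X : Matrix (Fin 2 → Fin n) (Fin 2 → Fin n) K) :
    Matrix (Fin 2 → Fin n) (Fin 2 → Fin n) K :=
  Matrix.of fun a b => X ![a 0, b 1] ![b 0, a 1]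

/-- The partial transpose `Q` of the flip operator, the rank-one matrix `v vᵀ` with
`v = ∑ eᵢ ⊗ eᵢ`. -/
def flipQ (n : ℕ) : Matrix (Fin 2 → Fin n) (Fin 2 → Fin n) K :=
  Matrix.of fun a b => if a 0 = a 1 ∧ b 0 = b 1 then 1 else 0

lemma flipP_apply (n : ℕ) (a b : Fin 2 → Fin n) :
    flipP K n a b = if b = ![a 1, a 0] then 1 else 0 := by
  refine if_congr ?_ rfl rfl
  simp [funext_iff, Fin.forall_fin_two, and_comm, eq_comm]

lemma flipP_mul_self (n : ℕ) : flipP K n * flipP K n = 1 := by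
  ext a b
  have ha : ![a 0, a 1] = a := by ext i; fin_cases i <;> rfl
  simp only [Matrix.mul_apply, flipP_apply, ite_mul, one_mul, zero_mul, Finset.sum_ite_eq',
    Finset.mem_univ, if_true]
  simp [Matrix.one_apply, ha, eq_comm (a := b)]

lemma flipQ_mul_self (n : ℕ) : flipQ K n * flipQ K n = (n : K) • flipQ K n := by
  ext a b
  rw [Matrix.mul_apply, ← (finTwoArrowEquiv (Fin n)).symm.sum_comp, Fintype.sum_prod_type]
  simp only [flipQ, Matrix.of_apply, finTwoArrowEquiv_symm_apply, Matrix.cons_val_zero,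
    Matrix.cons_val_one, Matrix.smul_apply, ite_and]
  by_cases ha : a 0 = a 1 <;> by_cases hb : b 0 = b 1 <;> simp [ha, hb]

lemma pt1_smul_one_add_smul_flipP (n : ℕ) (c d : K) :
    pt1 K (c • (1 + d • flipP K n)) = c • (1 + d • flipQ K n) := by
  ext a b
  simp only [pt1, flipP, flipQ, Matrix.of_apply, Matrix.smul_apply, Matrix.add_apply,
    Matrix.one_apply, funext_iff, Fin.forall_fin_two, Matrix.cons_val_zero, Matrix.cons_val_one]
  simp only [eq_comm, and_comm]

lemma pt2_smul_one_add_smul_flipP (n : ℕ) (c d : K) :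
    pt2 K (c • (1 + d • flipP K n)) = c • (1 + d • flipQ K n) := by
  ext a b
  simp only [pt2, flipP, flipQ, Matrix.of_apply, Matrix.smul_apply, Matrix.add_apply,
    Matrix.one_apply, funext_iff, Fin.forall_fin_two, Matrix.cons_val_zero, Matrix.cons_val_one]
  simp only [eq_comm]

lemma smul_Rbar_mul_smul_Rbar_neg (n : ℕ) {h u φ ψ : K} (hu : u ≠ 0) (hψ : ψ ≠ 0)
    (hrel : ψ = ((u ^ 2 - h ^ 2) / u ^ 2) * φ) :
    (φ • Rbar K n h u) * (ψ⁻¹ • (1 + (-(h / u)) • flipP K n)) = 1 := by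
  have hscal : φ * ψ⁻¹ * (1 - (h / u) ^ 2) = 1 := by
    have : ψ = (1 - (h / u) ^ 2) * φ := by rw [hrel]; field_simp
    rw [mul_right_comm, mul_comm φ, ← this, mul_inv_cancel₀ hψ]
  have hmul : (1 + (h / u) • flipP K n) * (1 + (-(h / u)) • flipP K n) =
      (1 - (h / u) ^ 2) • 1 := by
    simp only [add_mul, mul_add, smul_mul_assoc, mul_smul_comm, flipP_mul_self, one_mul, mul_one]
    module
  rw [Rbar, smul_mul_smul_comm, hmul, smul_smul, hscal, one_smul]

lemma one_add_smul_flipQ_mul (n : ℕ) {c d : K} (hcd : c + d + c * d * n = 0) :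
    (1 + c • flipQ K n) * (1 + d • flipQ K n) = 1 := by
  have hmul : (1 + c • flipQ K n) * (1 + d • flipQ K n) =
      1 + (c + d + c * d * n) • flipQ K n := by
    simp only [add_mul, mul_add, smul_mul_assoc, mul_smul_comm, flipQ_mul_self, one_mul, mul_one]
    module
  rw [hmul, hcd, zero_smul, add_zero]

/-- Crossing symmetry (Lemma 4.3): with `R(u) = φ·R̄(u)`, `R(u−nh) = ψ·R̄(u−nh)` and
`ψ = ((u²−h²)/u²)·φ`, the matrix `R(u)` is invertible and
`(R(u)⁻¹)^{t₂}·(R(u−nh))^{t₂} = 1` and `(R(u−nh))^{t₁}·(R(u)⁻¹)^{t₁} = 1`. -/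
theorem stmt3 (n : ℕ) (hn : 1 ≤ n) (h u φ ψ : K) (hu : u ≠ 0) (hu2 : u ^ 2 ≠ h ^ 2)
    (hun : u ≠ (n : K) * h) (hφ : φ ≠ 0) (hψ : ψ ≠ 0)
    (hrel : ψ = ((u ^ 2 - h ^ 2) / u ^ 2) * φ) :
    IsUnit (φ • Rbar K n h u) ∧
      pt2 K ((φ • Rbar K n h u)⁻¹) * pt2 K (ψ • Rbar K n h (u - (n : K) * h)) = 1 ∧
      pt1 K (ψ • Rbar K n h (u - (n : K) * h)) * pt1 K ((φ • Rbar K n h u)⁻¹) = 1 := by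
  have hmul := smul_Rbar_mul_smul_Rbar_neg K n hu hψ hrel
  have hun' : u - h * n ≠ 0 := sub_ne_zero.mpr (mul_comm h n ▸ hun)
  have hcd : -(h / u) + h / (u - n * h) + -(h / u) * (h / (u - n * h)) * n = 0 := by
    field_simp
    ring
  have hdc : h / (u - n * h) + -(h / u) + h / (u - n * h) * -(h / u) * n = 0 := by
    linear_combination hcd
  refine ⟨IsUnit.of_mul_eq_one _ hmul, ?_, ?_⟩
  · rw [Matrix.inv_eq_right_inv hmul, Rbar, pt2_smul_one_add_smul_flipP,
      pt2_smul_one_add_smul_flipP, smul_mul_smul_comm, one_add_smul_flipQ_mul K n hcd,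
      inv_mul_cancel₀ hψ, one_smul]
  · rw [Matrix.inv_eq_right_inv hmul, Rbar, pt1_smul_one_add_smul_flipP,
      pt1_smul_one_add_smul_flipP, smul_mul_smul_comm, one_add_smul_flipQ_mul K n hdc,
      mul_inv_cancel₀ hψ, one_smul]
end
end

section
/- (Part of Theorem 2.5, diagonal Gauss coordinates commute) Under the RTT hypothesis, the series k₁ and k₂ pairwise commute: k₁(u)·k₁(v) = k₁(v)·k₁(u), k₂(u)·k₂(v) = k₂(v)·k₂(u), and k₁(u)·k₂(v) = k₂(v)·k₁(u), as identities in A[[u^{-1}, v^{-1}]]. -/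
noncomputable section

variable {A : Type*} [Ring A]

/-- A power series in `u⁻¹` (given by its coefficients) viewed as a Hahn series over `ℤ`,
the exponent being the power of `u⁻¹`. -/
def ofSeq (a : ℕ → A) : HahnSeries ℤ A :=
  HahnSeries.ofPowerSeries ℤ A (PowerSeries.mk a)

/-- The ambient ring containing `A[[u⁻¹, v⁻¹]][u, v]`: iterated Hahn series over `ℤ`
(inner exponent = power of `u⁻¹`, outer exponent = power of `v⁻¹`). -/
abbrev TT (A : Type*) [Ring A] := HahnSeries ℤ (HahnSeries ℤ A)

/-- A power series in `u⁻¹` inside the two-variable ring. -/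
def inU (a : ℕ → A) : TT A := HahnSeries.single (0 : ℤ) (ofSeq a)

/-- A power series in `v⁻¹` inside the two-variable ring. -/
def inV (a : ℕ → A) : TT A := ofSeq (fun m => HahnSeries.single (0 : ℤ) (a m))

/-- A scalar of `A` inside the two-variable ring. -/
def sc (a : A) : TT A := HahnSeries.single (0 : ℤ) (HahnSeries.single (0 : ℤ) a)

/-- The element `u`. -/
def Uv (A : Type*) [Ring A] : TT A := HahnSeries.single (0 : ℤ) (HahnSeries.single (-1 : ℤ) 1)

/-- The element `v`. -/
def Vv (A : Type*) [Ring A] : TT A := HahnSeries.single (-1 : ℤ) 1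

/-- The coefficient sequence of `l_{ij}(u) = δ_{ij} − h·Σ_{r≥0} l_{ij}^{(r)} u^{−r−1}`,
built from the generators `lgen i j r = l_{ij}^{(r)}`. -/
def lcoef {N : ℕ} (h : A) (lgen : Fin N → Fin N → ℕ → A) (i j : Fin N) : ℕ → A :=
  fun r => if r = 0 then (if i = j then 1 else 0) else -(h * lgen i j (r - 1))

/-- The RTT relation for Yang's R-matrix, with denominators cleared:
`(u−v)(l_{ij}(u)l_{kl}(v) − l_{kl}(v)l_{ij}(u)) = h(l_{kj}(v)l_{il}(u) − l_{kj}(u)l_{il}(v))`. -/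
def RTT {N : ℕ} (h : A) (lgen : Fin N → Fin N → ℕ → A) : Prop :=
  ∀ i j k l : Fin N,
    (Uv A - Vv A) *
        (inU (lcoef h lgen i j) * inV (lcoef h lgen k l) -
          inV (lcoef h lgen k l) * inU (lcoef h lgen i j)) =
      sc h *
        (inV (lcoef h lgen k j) * inU (lcoef h lgen i l) -
          inU (lcoef h lgen k j) * inV (lcoef h lgen i l))

/-- `k₁(u) = l₁₁(u)` as a series in `u`. -/
def k1U (h : A) (lgen : Fin 2 → Fin 2 → ℕ → A) : TT A := inU (lcoef h lgen 0 0)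

/-- `k₁(v)` as a series in `v`. -/
def k1V (h : A) (lgen : Fin 2 → Fin 2 → ℕ → A) : TT A := inV (lcoef h lgen 0 0)

/-- `e(u) = k₁(u)⁻¹·l₁₂(u)`, given the inverse `k1uinv` of `k₁(u)`. -/
def eU (h : A) (lgen : Fin 2 → Fin 2 → ℕ → A) (k1uinv : TT A) : TT A :=
  k1uinv * inU (lcoef h lgen 0 1)

def eV (h : A) (lgen : Fin 2 → Fin 2 → ℕ → A) (k1vinv : TT A) : TT A :=
  k1vinv * inV (lcoef h lgen 0 1)

/-- `f(u) = l₂₁(u)·k₁(u)⁻¹`. -/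
def fU (h : A) (lgen : Fin 2 → Fin 2 → ℕ → A) (k1uinv : TT A) : TT A :=
  inU (lcoef h lgen 1 0) * k1uinv

def fV (h : A) (lgen : Fin 2 → Fin 2 → ℕ → A) (k1vinv : TT A) : TT A :=
  inV (lcoef h lgen 1 0) * k1vinv

/-- `k₂(u) = l₂₂(u) − f(u)·k₁(u)·e(u)`. -/
def k2U (h : A) (lgen : Fin 2 → Fin 2 → ℕ → A) (k1uinv : TT A) : TT A :=
  inU (lcoef h lgen 1 1) - fU h lgen k1uinv * k1U h lgen * eU h lgen k1uinv

def k2V (h : A) (lgen : Fin 2 → Fin 2 → ℕ → A) (k1vinv : TT A) : TT A :=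
  inV (lcoef h lgen 1 1) - fV h lgen k1vinv * k1V h lgen * eV h lgen k1vinv

/-- The commutator with an inverse, in terms of the commutator with the original element. -/
lemma smul_commutator_inv {S R : Type*} [CommRing S] [Ring R] [Module S R] [IsScalarTower S R R]
    [SMulCommClass S R R] {w : S} {x y y' : R} {r : R} (hy : y * y' = 1) (hy' : y' * y = 1)
    (hx : w • (x * y - y * x) = r) : w • (x * y' - y' * x) = -(y' * r * y') := by
  have h₁ (z : R) : y' * (y * z) = z := by rw [← mul_assoc, hy', one_mul]
  rw [← hx]
  simp only [mul_assoc, mul_sub, sub_mul, smul_sub, mul_smul_comm, smul_mul_assoc, hy, h₁, mul_one]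
  abel

/-- The diagonal Gauss coordinates of two `2 × 2` matrices `(a, b; c, d)` and `(a', b'; c', d')`
intertwined by `w + h P` commute. Here `I`, `J` are the inverses of `a`, `a'`. -/
theorem gauss_diagonal_commute {S R : Type*} [CommRing S] [Ring R] [Module S R]
    [IsScalarTower S R R] [SMulCommClass S R R] {w h : S} {a b c d a' b' c' d' I J : R}
    (hw : ∀ x : R, w • x = 0 → x = 0) (hwh : ∀ x : R, (w + h) • x = 0 → x = 0)
    (haI : a * I = 1) (hIa : I * a = 1) (haJ : a' * J = 1) (hJa : J * a' = 1)
    (haa : w • (a * a' - a' * a) = h • (a' * a - a * a'))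
    (hab : w • (a * b' - b' * a) = h • (a' * b - a * b'))
    (hac : w • (a * c' - c' * a) = h • (c' * a - c * a'))
    (had : w • (a * d' - d' * a) = h • (c' * b - c * b'))
    (hba : w • (b * a' - a' * b) = h • (b' * a - b * a'))
    (hbb : w • (b * b' - b' * b) = h • (b' * b - b * b'))
    (hbc : w • (b * c' - c' * b) = h • (d' * a - d * a'))
    (hbd : w • (b * d' - d' * b) = h • (d' * b - d * b'))
    (hca : w • (c * a' - a' * c) = h • (a' * c - a * c'))
    (hcb : w • (c * b' - b' * c) = h • (a' * d - a * d'))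
    (hcc : w • (c * c' - c' * c) = h • (c' * c - c * c'))
    (hcd : w • (c * d' - d' * c) = h • (c' * d - c * d'))
    (hda : w • (d * a' - a' * d) = h • (b' * c - b * c'))
    (hdb : w • (d * b' - b' * d) = h • (b' * d - b * d'))
    (hdc : w • (d * c' - c' * d) = h • (d' * c - d * c'))
    (hdd : w • (d * d' - d' * d) = h • (d' * d - d * d')) :
    a * a' = a' * a ∧
      (d - c * I * b) * (d' - c' * J * b') = (d' - c' * J * b') * (d - c * I * b) ∧
      a * (d' - c' * J * b') = (d' - c' * J * b') * a := by
  have comm_of {x y : R} (H : w • (x * y - y * x) = h • (y * x - x * y)) : x * y = y * x :=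
    sub_eq_zero.1 (hwh _ (by linear_combination (norm := module) H))
  have caa := comm_of haa
  have cbb := comm_of hbb
  have ccc := comm_of hcc
  have caJ : a * J = J * a := by
    calc a * J = J * (a' * a) * J := by rw [← mul_assoc, hJa, one_mul]
      _ = J * a := by rw [← caa, mul_assoc, mul_assoc, haJ, mul_one]
  have hbJ := smul_commutator_inv haJ hJa hba
  have hcJ := smul_commutator_inv haJ hJa hca
  have hdJ := smul_commutator_inv haJ hJa hda
  have cancel_aJ (z : R) : a' * (J * z) = z := by rw [← mul_assoc, haJ, one_mul]
  have cancel_Ja (z : R) : J * (a' * z) = z := by rw [← mul_assoc, hJa, one_mul]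
  have cancel_aI (z : R) : a * (I * z) = z := by rw [← mul_assoc, haI, one_mul]
  have cancel_Ia (z : R) : I * (a * z) = z := by rw [← mul_assoc, hIa, one_mul]
  have caJ' (z : R) : a * (J * z) = J * (a * z) := by rw [← mul_assoc, caJ, mul_assoc]
  have ccc' (z : R) : c * (c' * z) = c' * (c * z) := by rw [← mul_assoc, ccc, mul_assoc]
  obtain ⟨D, hD⟩ : ∃ D, D = d' - c' * J * b' := ⟨_, rfl⟩
  obtain rfl : d' = D + c' * J * b' := by rw [hD]; abel
  rw [add_sub_cancel_right]
  have caD : a * D = D * a := by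
    refine sub_eq_zero.1 (hw _ ?_)
    linear_combination (norm := skip) had - hac * (J * b') - c' * J * hab
    simp only [mul_assoc, mul_sub, sub_mul, mul_add, add_mul, smul_sub, smul_add, mul_smul_comm,
      smul_mul_assoc, cancel_aJ, cancel_Ja, caJ']
    module
  have caD' (z : R) : a * (D * z) = D * (a * z) := by rw [← mul_assoc, caD, mul_assoc]
  have cID (z : R) : I * (D * z) = D * (I * z) := by
    calc I * (D * z) = I * (D * (a * (I * z))) := by rw [cancel_aI]
      _ = D * (I * z) := by rw [← caD', cancel_Ia]
  have hbD : w • (b * D - D * b) = h • (D * (b - a * (J * b'))) := by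
    linear_combination (norm := skip) hbd - hbc * (J * b') - c' * hbJ * b'
    simp only [mul_assoc, mul_sub, sub_mul, mul_add, add_mul, smul_sub, smul_add, mul_smul_comm,
      smul_mul_assoc, mul_neg, neg_mul, cancel_aJ, haJ, mul_one, cbb, caJ, caJ']
    module
  have hcD : w • (c * D - D * c) = h • ((c' * J * a - c) * D) := by
    linear_combination (norm := skip) hcd - c' * hcJ * b' - c' * J * hcb
    simp only [mul_assoc, mul_sub, sub_mul, mul_add, add_mul, smul_sub, smul_add, mul_smul_comm,
      smul_mul_assoc, mul_neg, neg_mul, cancel_Ja, ccc']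
    module
  have hdD : (w + h) • (d * D - D * d) = h • (c' * J * b * D - D * c * (J * b')) := by
    linear_combination (norm := skip) hdd - hdc * (J * b') - c' * hdJ * b' - c' * J * hdb
    simp only [mul_assoc, mul_sub, sub_mul, mul_add, add_mul, smul_sub, smul_add, mul_smul_comm,
      smul_mul_assoc, mul_neg, neg_mul]
    module
  refine ⟨caa, sub_eq_zero.1 (hw _ (hwh _ ?_)), caD⟩
  linear_combination (norm := skip) w • hdD + h • (c' * J * hbD) + h • (hcD * (J * b')) -
    (w + h) • (hcD * (I * b)) - (w + h) • (c * I * hbD)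
  simp only [mul_assoc, mul_sub, sub_mul, smul_sub, mul_smul_comm,
    smul_mul_assoc, cancel_aI, cancel_Ia, caD, cID]
  module

/-- The diagonal Gauss coordinates of two `2 × 2` matrices satisfying the RTT relation with
central parameters `w`, `h` commute. -/
theorem gauss_diagonal_commute_of_mem_center {R : Type*} [Ring R] {w h I J : R}
    {L L' : Fin 2 → Fin 2 → R} (hwc : w ∈ Subring.center R) (hhc : h ∈ Subring.center R)
    (hw : ∀ x : R, w * x = 0 → x = 0) (hwh : ∀ x : R, (w + h) * x = 0 → x = 0)
    (hI : L 0 0 * I = 1 ∧ I * L 0 0 = 1) (hJ : L' 0 0 * J = 1 ∧ J * L' 0 0 = 1)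
    (H : ∀ i j k l, w * (L i j * L' k l - L' k l * L i j) =
      h * (L' k j * L i l - L k j * L' i l)) :
    L 0 0 * L' 0 0 = L' 0 0 * L 0 0 ∧
      (L 1 1 - L 1 0 * I * L 0 1) * (L' 1 1 - L' 1 0 * J * L' 0 1) =
        (L' 1 1 - L' 1 0 * J * L' 0 1) * (L 1 1 - L 1 0 * I * L 0 1) ∧
      L 0 0 * (L' 1 1 - L' 1 0 * J * L' 0 1) = (L' 1 1 - L' 1 0 * J * L' 0 1) * L 0 0 :=
  gauss_diagonal_commute (S := Subring.center R) (w := ⟨w, hwc⟩) (h := ⟨h, hhc⟩) hw hwh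
    hI.1 hI.2 hJ.1 hJ.2 (H 0 0 0 0) (H 0 0 0 1) (H 0 0 1 0) (H 0 0 1 1)
    (H 0 1 0 0) (H 0 1 0 1) (H 0 1 1 0) (H 0 1 1 1) (H 1 0 0 0) (H 1 0 0 1) (H 1 0 1 0)
    (H 1 0 1 1) (H 1 1 0 0) (H 1 1 0 1) (H 1 1 1 0) (H 1 1 1 1)

/-- A linear polynomial in `v` with leading coefficient `-1` is left regular. -/
lemma eq_zero_of_single_sub_mul {B : Type*} [Ring B] (c : B) (x : HahnSeries ℤ B)
    (H : (HahnSeries.single (0 : ℤ) c - HahnSeries.single (-1 : ℤ) 1) * x = 0) : x = 0 := by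
  by_contra hx
  have H' := congrArg (fun y => HahnSeries.coeff y (x.order - 1)) H
  have hlt : x.coeff (x.order - 1) = 0 := HahnSeries.coeff_eq_zero_of_lt_order (by omega)
  have hs : (HahnSeries.single (-1 : ℤ) (1 : B) * x).coeff (x.order - 1) = x.coeff x.order := by
    have := HahnSeries.coeff_single_mul_add (r := (1 : B)) (x := x) (a := x.order) (b := (-1 : ℤ))
    rwa [one_mul, ← sub_eq_add_neg] at this
  rw [sub_mul] at H'
  simp only [HahnSeries.coeff_sub, HahnSeries.coeff_single_zero_mul, hlt, hs, mul_zero, zero_sub,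
    HahnSeries.coeff_zero, neg_eq_zero] at H'
  exact hx (HahnSeries.coeff_order_eq_zero.1 H')

/-- A monomial with central coefficient is central. -/
lemma single_mem_center {B : Type*} [Ring B] (n : ℤ) {c : B} (hc : c ∈ Subring.center B) :
    HahnSeries.single n c ∈ Subring.center (HahnSeries ℤ B) := by
  rw [Subring.mem_center_iff] at hc ⊢
  intro x
  ext m
  have h₁ := HahnSeries.coeff_single_mul_add (r := c) (x := x) (a := m - n) (b := n)
  have h₂ := HahnSeries.coeff_mul_single_add (r := c) (x := x) (a := m - n) (b := n)
  rw [sub_add_cancel] at h₁ h₂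
  rw [h₁, h₂, hc]

theorem stmt12 (h : A) (hcen : ∀ a : A, a * h = h * a)
    (lgen : Fin 2 → Fin 2 → ℕ → A) (hRTT : RTT h lgen)
    (k1uinv k1vinv : TT A)
    (hk1u : k1U h lgen * k1uinv = 1 ∧ k1uinv * k1U h lgen = 1)
    (hk1v : k1V h lgen * k1vinv = 1 ∧ k1vinv * k1V h lgen = 1) :
    k1U h lgen * k1V h lgen = k1V h lgen * k1U h lgen ∧
      k2U h lgen k1uinv * k2V h lgen k1vinv = k2V h lgen k1vinv * k2U h lgen k1uinv ∧
      k1U h lgen * k2V h lgen k1vinv = k2V h lgen k1vinv * k1U h lgen := by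
  have hwc : Uv A - Vv A ∈ Subring.center (TT A) := sub_mem
    (single_mem_center _ (single_mem_center _ (one_mem _))) (single_mem_center _ (one_mem _))
  have hhc : sc h ∈ Subring.center (TT A) := single_mem_center _ (single_mem_center _
    (Subring.mem_center_iff.2 hcen))
  have hw (x : TT A) (hx : (Uv A - Vv A) * x = 0) : x = 0 := eq_zero_of_single_sub_mul _ x hx
  have hwh (x : TT A) (hx : (Uv A - Vv A + sc h) * x = 0) : x = 0 := by
    refine eq_zero_of_single_sub_mul (HahnSeries.single (-1 : ℤ) 1 + HahnSeries.single 0 h) x ?_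
    rw [HahnSeries.single_add, add_sub_right_comm]
    exact hx
  have hU : k2U h lgen k1uinv =
      inU (lcoef h lgen 1 1) - inU (lcoef h lgen 1 0) * k1uinv * inU (lcoef h lgen 0 1) := by
    have : k1uinv * k1U h lgen = 1 := hk1u.2
    rw [k2U, fU, eU, mul_assoc (inU _), this, mul_one, ← mul_assoc]
  have hV : k2V h lgen k1vinv =
      inV (lcoef h lgen 1 1) - inV (lcoef h lgen 1 0) * k1vinv * inV (lcoef h lgen 0 1) := by
    have : k1vinv * k1V h lgen = 1 := hk1v.2
    rw [k2V, fV, eV, mul_assoc (inV _), this, mul_one, ← mul_assoc]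
  rw [hU, hV]
  exact gauss_diagonal_commute_of_mem_center (L := fun i j => inU (lcoef h lgen i j))
    (L' := fun i j => inV (lcoef h lgen i j)) hwc hhc hw hwh hk1u hk1v hRTT
end
end

section
/- (Part of Theorem 2.5, relations (2.35)–(2.36)) Under the RTT hypothesis, (u−v)·k₁(u)^{-1}·e(v)·k₁(u) = (u−v+h)·e(v) − h·e(u) and (u−v)·k₁(u)·f(v)·k₁(u)^{-1} = (u−v+h)·f(v) − h·f(u), as identities in A[[u^{-1}, v^{-1}]][u, v]. -/
noncomputable section

variable {A : Type*} [Ring A]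

theorem commute_hahnSeries_single {R : Type*} [Ring R] (n : ℤ) (r : R) (x : HahnSeries ℤ R)
    (hr : ∀ m, Commute r (x.coeff m)) : Commute (HahnSeries.single n r) x := by
  ext m
  rw [HahnSeries.coeff_single_mul, HahnSeries.coeff_mul_single]
  exact hr (m - n)

theorem commute_Uv (x : TT A) : Commute (Uv A) x :=
  commute_hahnSeries_single _ _ _ fun _ =>
    commute_hahnSeries_single _ _ _ fun _ => Commute.one_left _

theorem commute_Vv (x : TT A) : Commute (Vv A) x :=
  commute_hahnSeries_single _ _ _ fun _ => Commute.one_left _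

theorem commute_sc {h : A} (hcen : ∀ a : A, a * h = h * a) (x : TT A) : Commute (sc h) x :=
  commute_hahnSeries_single _ _ _ fun _ =>
    commute_hahnSeries_single _ _ _ fun _ => (hcen _).symm

/-- The element `u - v + h` is left regular: its leading coefficient in `v⁻¹` is `-1`. -/
theorem eq_zero_of_Uv_sub_Vv_add_sc_mul_eq_zero (h : A) {x : TT A}
    (hx : (Uv A - Vv A + sc h) * x = 0) : x = 0 := by
  by_contra hne
  have hlow : x.coeff (x.order - 1) = 0 := HahnSeries.coeff_eq_zero_of_lt_order (by lia)
  have hV : (Vv A * x).coeff (x.order - 1) = x.coeff x.order := by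
    rw [Vv, HahnSeries.coeff_single_mul, one_mul, sub_neg_eq_add, sub_add_cancel]
  have hU : ((Uv A + sc h) * x).coeff (x.order - 1) = 0 := by
    rw [add_mul, HahnSeries.coeff_add, Uv, sc, HahnSeries.coeff_single_zero_mul,
      HahnSeries.coeff_single_zero_mul, hlow, mul_zero, mul_zero, add_zero]
  have hUV : (Uv A + sc h) * x = Vv A * x := by
    rw [← sub_eq_zero, ← sub_mul, ← hx, sub_add_eq_add_sub]
  rw [hUV, hV] at hU
  exact hne (HahnSeries.coeff_order_eq_zero.mp hU)

section

variable {R : Type*} [Ring R] {d c a b p q a' b' : R}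

/-- Conjugation by `a⁻¹` of the Gauss coordinate `b⁻¹ q`, from the exchange relation of `a`
and `q`. -/
theorem mul_conj_inv_mul_of_exchange (hd : ∀ x, Commute d x) (hc : ∀ x, Commute c x)
    (ha : a * a' = 1 ∧ a' * a = 1) (hb : b * b' = 1 ∧ b' * b = 1) (hab : Commute a b)
    (hq : d * (a * q - q * a) = c * (b * p - a * q)) :
    d * (a' * (b' * q) * a) = (d + c) * (b' * q) - c * (a' * p) := by
  have hab' : Commute a b' := hab.units_inv_right (u := ⟨b, b', hb.1, hb.2⟩)
  have hba' : Commute a' b' := hab'.units_inv_left (u := ⟨a, a', ha.1, ha.2⟩)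
  have hq' : d * (q * a) = d * (a * q) - c * (b * p - a * q) := by
    rw [← hq]
    noncomm_ring
  have hcancel : a' * b' * (a * q) = b' * q := by
    rw [hba'.eq, mul_assoc, ← mul_assoc a', ha.2, one_mul]
  have hcancel' : a' * b' * (b * p) = a' * p := by
    rw [mul_assoc, ← mul_assoc b', hb.2, one_mul]
  calc d * (a' * (b' * q) * a) = a' * b' * (d * (q * a)) := by
        rw [← mul_assoc (a' * b'), ← (hd (a' * b')).eq]
        noncomm_ring
    _ = d * (a' * b' * (a * q)) - c * (a' * b' * (b * p) - a' * b' * (a * q)) := by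
        rw [hq', mul_sub, ← mul_assoc (a' * b') d, ← (hd (a' * b')).eq,
          ← mul_assoc (a' * b') c, ← (hc (a' * b')).eq]
        noncomm_ring
    _ = (d + c) * (b' * q) - c * (a' * p) := by
        rw [hcancel, hcancel']
        noncomm_ring

/-- Conjugation by `a` of the Gauss coordinate `q b⁻¹`, from the exchange relation of `a`
and `q`. -/
theorem mul_conj_mul_inv_of_exchange
    (ha : a * a' = 1 ∧ a' * a = 1) (hb : b * b' = 1 ∧ b' * b = 1) (hab : Commute a b)
    (hq : d * (a * q - q * a) = c * (q * a - p * b)) :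
    d * (a * (q * b') * a') = (d + c) * (q * b') - c * (p * a') := by
  have hab' : Commute a b' := hab.units_inv_right (u := ⟨b, b', hb.1, hb.2⟩)
  have hba' : Commute a' b' := hab'.units_inv_left (u := ⟨a, a', ha.1, ha.2⟩)
  have hq' : d * (a * q) = d * (q * a) + c * (q * a - p * b) := by
    rw [← hq]
    noncomm_ring
  have hcancel : q * a * (b' * a') = q * b' := by
    rw [← hba'.eq, mul_assoc, ← mul_assoc a, ha.1, one_mul]
  have hcancel' : p * b * (b' * a') = p * a' := by
    rw [mul_assoc, ← mul_assoc b, hb.1, one_mul]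
  calc d * (a * (q * b') * a') = d * (a * q) * (b' * a') := by noncomm_ring
    _ = d * (q * a * (b' * a')) + c * (q * a * (b' * a') - p * b * (b' * a')) := by
        rw [hq']
        noncomm_ring
    _ = (d + c) * (q * b') - c * (p * a') := by
        rw [hcancel, hcancel']
        noncomm_ring

end

/-- The series `k₁(u)` and `k₁(v)` commute. -/
theorem commute_k1U_k1V {h : A} {lgen : Fin 2 → Fin 2 → ℕ → A} (hRTT : RTT h lgen) :
    Commute (k1U h lgen) (k1V h lgen) := by
  refine sub_eq_zero.mp (eq_zero_of_Uv_sub_Vv_add_sc_mul_eq_zero h ?_)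
  rw [add_mul, k1U, k1V, hRTT 0 0 0 0, ← mul_add, sub_add_sub_cancel, sub_self, mul_zero]

/-- Relations (2.35)–(2.36):
`(u−v)·k₁(u)⁻¹·e(v)·k₁(u) = (u−v+h)·e(v) − h·e(u)` and
`(u−v)·k₁(u)·f(v)·k₁(u)⁻¹ = (u−v+h)·f(v) − h·f(u)`. -/
theorem stmt13 (h : A) (hcen : ∀ a : A, a * h = h * a)
    (lgen : Fin 2 → Fin 2 → ℕ → A) (hRTT : RTT h lgen)
    (k1uinv k1vinv : TT A)
    (hk1u : k1U h lgen * k1uinv = 1 ∧ k1uinv * k1U h lgen = 1)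
    (hk1v : k1V h lgen * k1vinv = 1 ∧ k1vinv * k1V h lgen = 1) :
    (Uv A - Vv A) * (k1uinv * eV h lgen k1vinv * k1U h lgen) =
        ((Uv A - Vv A) + sc h) * eV h lgen k1vinv - sc h * eU h lgen k1uinv ∧
      (Uv A - Vv A) * (k1U h lgen * fV h lgen k1vinv * k1uinv) =
        ((Uv A - Vv A) + sc h) * fV h lgen k1vinv - sc h * fU h lgen k1uinv := by
  have hD (x : TT A) : Commute (Uv A - Vv A) x := (commute_Uv x).sub_left (commute_Vv x)
  have hk := commute_k1U_k1V hRTT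
  exact ⟨mul_conj_inv_mul_of_exchange hD (commute_sc hcen) hk1u hk1v hk (hRTT 0 0 0 1),
    mul_conj_mul_inv_of_exchange hk1u hk1v hk (hRTT 0 0 1 0)⟩
end
end

section
/- (Part of Theorem 2.5, relations (2.63)–(2.64)) Under the RTT hypothesis, (u−v)·k₂(v)^{-1}·e(u)·k₂(v) = (u−v+h)·e(u) − h·e(v) and (u−v)·k₂(v)·f(u)·k₂(v)^{-1} = (u−v+h)·f(u) − h·f(v), as identities in A[[u^{-1}, v^{-1}]][u, v]. -/
noncomputable section

variable {A : Type*} [Ring A]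

/-- A monomial with central coefficient is central among Hahn series. -/
theorem commute_single_of_commute {R : Type*} [Ring R] {r : R} (hr : ∀ a, Commute r a) (n : ℤ)
    (x : HahnSeries ℤ R) : Commute (HahnSeries.single n r) x := by
  ext m
  obtain ⟨k, rfl⟩ : ∃ k, m = k + n := ⟨m - n, by ring⟩
  rw [HahnSeries.coeff_single_mul_add, HahnSeries.coeff_mul_single_add]
  exact hr _

section GaussCoordinates

variable {R : Type*} [Ring R]

/-- If `(x, y)` is the second column and `(z, y)` the second row of the inverse of the matrix
`!![a, b; c, d]`, then the commutators of `w` with the matrix entries determine that of `w`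
with `y`. -/
theorem inverse_entry_commutator {a b c d x y z w : R}
    (hc₁ : a * x + b * y = 0) (hc₂ : c * x + d * y = 1)
    (hr₁ : z * a + y * c = 0) (hr₂ : z * b + y * d = 1) :
    z * (w * a - a * w) * x + z * (w * b - b * w) * y +
      y * (w * c - c * w) * x + y * (w * d - d * w) * y = y * w - w * y := by
  calc
    _ = z * w * (a * x + b * y) + y * w * (c * x + d * y) -
          (z * a + y * c) * w * x - (z * b + y * d) * w * y := by noncomm_ring
    _ = y * w - w * y := by rw [hc₁, hc₂, hr₁, hr₂]; noncomm_ring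

/-- The RTT relation between a matrix `S` and a matrix `T`, contracted with the second row
`(z, y)` and the second column `(x, y)` of the inverse of `T`. -/
theorem rtt_inverse_entry {D H x y z : R} {S T : Fin 2 → Fin 2 → R}
    (hD : ∀ t, Commute D t) (hH : ∀ t, Commute H t)
    (hrtt : ∀ i j k l, D * (S i j * T k l - T k l * S i j) =
      H * (T k j * S i l - S k j * T i l))
    (hc₁ : T 0 0 * x + T 0 1 * y = 0) (hc₂ : T 1 0 * x + T 1 1 * y = 1)
    (hr₁ : z * T 0 0 + y * T 1 0 = 0) (hr₂ : z * T 0 1 + y * T 1 1 = 1) (i j : Fin 2) :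
    D * (y * S i j - S i j * y) =
      H * ((z * T 0 j + y * T 1 j) * (S i 0 * x + S i 1 * y) -
        (z * S 0 j + y * S 1 j) * (T i 0 * x + T i 1 * y)) := by
  have move (p q s t : R) {r : R} (h : D * s = H * t) (hr : r = p * s * q) :
      D * r = H * (p * t * q) := by
    rw [hr, mul_assoc p, ← mul_assoc D, (hD p).eq, mul_assoc p, ← mul_assoc D, h,
      mul_assoc H, ← mul_assoc p, ← (hH p).eq, mul_assoc H, mul_assoc p]
  rw [← inverse_entry_commutator (w := S i j) hc₁ hc₂ hr₁ hr₂, mul_add, mul_add, mul_add,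
    move z x _ _ (hrtt i j 0 0) rfl, move z y _ _ (hrtt i j 0 1) rfl,
    move y x _ _ (hrtt i j 1 0) rfl, move y y _ _ (hrtt i j 1 1) rfl]
  noncomm_ring

/-- Conjugation of the off-diagonal Gauss coordinates of `S` by the second diagonal Gauss
coordinate `k` of `T`, for matrices `S`, `T` satisfying the RTT relation. -/
theorem rtt_conj_gauss {D H σ τ k y : R} {S T : Fin 2 → Fin 2 → R}
    (hD : ∀ t, Commute D t) (hH : ∀ t, Commute H t)
    (hrtt : ∀ i j k l, D * (S i j * T k l - T k l * S i j) =
      H * (T k j * S i l - S k j * T i l))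
    (hσ : S 0 0 * σ = 1) (hσ' : σ * S 0 0 = 1) (hτ : T 0 0 * τ = 1) (hτ' : τ * T 0 0 = 1)
    (hk : k = T 1 1 - T 1 0 * τ * T 0 1) (hky : k * y = 1) (hyk : y * k = 1) :
    D * (y * (σ * S 0 1) * k) = (D + H) * (σ * S 0 1) - H * (τ * T 0 1) ∧
      D * (k * (S 1 0 * σ) * y) = (D + H) * (S 1 0 * σ) - H * (T 1 0 * τ) := by
  have hc₁ : T 0 0 * (-(τ * T 0 1 * y)) + T 0 1 * y = 0 := by
    simp only [mul_neg, ← mul_assoc, hτ, one_mul, neg_add_cancel]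
  have hc₂ : T 1 0 * (-(τ * T 0 1 * y)) + T 1 1 * y = 1 := by
    rw [← hky, hk]; noncomm_ring
  have hr₁ : -(y * (T 1 0 * τ)) * T 0 0 + y * T 1 0 = 0 := by
    simp only [neg_mul, mul_assoc, hτ', mul_one, neg_add_cancel]
  have hr₂ : -(y * (T 1 0 * τ)) * T 0 1 + y * T 1 1 = 1 := by
    rw [← hyk, hk]; noncomm_ring
  have key := rtt_inverse_entry hD hH hrtt hc₁ hc₂ hr₁ hr₂
  have h00 := key 0 0
  have h01 := key 0 1
  have h10 := key 1 0
  rw [hr₁, hc₁, zero_mul, mul_zero, sub_zero, mul_zero] at h00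
  rw [hr₂, hc₁, one_mul, mul_zero, sub_zero] at h01
  rw [hr₁, hc₂, zero_mul, mul_one, zero_sub] at h10
  have hDσ : D * (σ * y) = D * (y * σ) := by
    have h : σ * (D * (y * S 0 0 - S 0 0 * y)) * σ =
        D * (σ * y * (S 0 0 * σ) - (σ * S 0 0) * y * σ) := by
      rw [← mul_assoc σ, ← (hD σ).eq]; noncomm_ring
    rw [h00, hσ, hσ', mul_zero, zero_mul, mul_one, one_mul, mul_sub] at h
    exact sub_eq_zero.mp h.symm
  constructor
  · have h : σ * (D * (y * S 0 1 - S 0 1 * y)) * k =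
        D * (σ * y) * S 0 1 * k - D * (σ * S 0 1) * (y * k) := by
      rw [← mul_assoc σ, ← (hD σ).eq]; noncomm_ring
    have h' : σ * (H * (S 0 0 * (-(τ * T 0 1 * y)) + S 0 1 * y)) * k =
        H * (σ * S 0 1 * (y * k) - (σ * S 0 0) * (τ * T 0 1) * (y * k)) := by
      rw [← mul_assoc σ, ← (hH σ).eq]; noncomm_ring
    rw [h01, h', hDσ, hyk, hσ', mul_one, mul_one, mul_one, one_mul] at h
    rw [add_mul, add_sub_assoc, ← mul_sub, h]
    noncomm_ring
  · have h : k * (D * (y * S 1 0 - S 1 0 * y)) * σ =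
        D * (k * y * (S 1 0 * σ)) - k * S 1 0 * (D * (y * σ)) := by
      rw [← mul_assoc k, ← (hD k).eq, ← mul_assoc (k * S 1 0), ← (hD (k * S 1 0)).eq]
      noncomm_ring
    have h' : k * (H * -(-(y * (T 1 0 * τ)) * S 0 0 + y * S 1 0)) * σ =
        H * (k * y * (T 1 0 * τ) * (S 0 0 * σ) - k * y * (S 1 0 * σ)) := by
      rw [← mul_assoc k, ← (hH k).eq]; noncomm_ring
    rw [h10, h', ← hDσ, hky, hσ, mul_one, one_mul, one_mul, ← mul_assoc (k * S 1 0),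
      ← (hD (k * S 1 0)).eq] at h
    have h'' : D * (k * (S 1 0 * σ) * y) = D * (k * S 1 0) * (σ * y) := by noncomm_ring
    rw [h'', ← sub_eq_zero, ← sub_eq_zero.mpr h]
    noncomm_ring

end GaussCoordinates

/-- Relations (2.63)–(2.64):
`(u−v)·k₂(v)⁻¹·e(u)·k₂(v) = (u−v+h)·e(u) − h·e(v)` and
`(u−v)·k₂(v)·f(u)·k₂(v)⁻¹ = (u−v+h)·f(u) − h·f(v)`. -/
theorem stmt14 (h : A) (hcen : ∀ a : A, a * h = h * a)
    (lgen : Fin 2 → Fin 2 → ℕ → A) (hRTT : RTT h lgen)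
    (k1uinv k1vinv k2vinv : TT A)
    (hk1u : k1U h lgen * k1uinv = 1 ∧ k1uinv * k1U h lgen = 1)
    (hk1v : k1V h lgen * k1vinv = 1 ∧ k1vinv * k1V h lgen = 1)
    (hk2v : k2V h lgen k1vinv * k2vinv = 1 ∧ k2vinv * k2V h lgen k1vinv = 1) :
    (Uv A - Vv A) * (k2vinv * eU h lgen k1uinv * k2V h lgen k1vinv) =
        ((Uv A - Vv A) + sc h) * eU h lgen k1uinv - sc h * eV h lgen k1vinv ∧
      (Uv A - Vv A) * (k2V h lgen k1vinv * fU h lgen k1uinv * k2vinv) =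
        ((Uv A - Vv A) + sc h) * fU h lgen k1uinv - sc h * fV h lgen k1vinv := by
  have hk : k2V h lgen k1vinv = inV (lcoef h lgen 1 1) -
      inV (lcoef h lgen 1 0) * k1vinv * inV (lcoef h lgen 0 1) := by
    rw [k2V, fV, eV, mul_assoc (inV (lcoef h lgen 1 0)), hk1v.2, mul_one, ← mul_assoc]
  exact rtt_conj_gauss (S := fun i j => inU (lcoef h lgen i j))
    (T := fun i j => inV (lcoef h lgen i j))
    (fun t => (commute_Uv t).sub_left (commute_Vv t)) (commute_sc hcen) hRTT
    hk1u.1 hk1u.2 hk1v.1 hk1v.2 hk hk2v.1 hk2v.2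
end
end

section
/- (Part of Theorem 2.5, relations (2.49) and (2.54)) Under the RTT hypothesis, (u−v+h)·e(v)·e(u) − (u−v−h)·e(u)·e(v) = h·(e(u)² + e(v)²) and (u−v+h)·f(u)·f(v) − (u−v−h)·f(v)·f(u) = h·(f(u)² + f(v)²), as identities in A[[u^{-1}, v^{-1}]][u, v]. -/
noncomputable section

variable {A : Type*} [Ring A]

/-- If two invertible elements `x, y` and two elements `z, w` satisfy the exchange relations of
an RTT algebra, with `d + h` acting regularly, then `x⁻¹ z` and `y⁻¹ w` satisfy a quadratic
exchange relation. -/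
theorem gauss_exchange {S R : Type*} [CommRing S] [Ring R] [Algebra S R] {d h : S}
    (hreg : ∀ r : R, (d + h) • r = 0 → r = 0) {a a' b b' p q : R}
    (hap : a * p = 1) (hpa : p * a = 1) (haq : a' * q = 1) (hqa : q * a' = 1)
    (haa : d • (a * a' - a' * a) = h • (a' * a - a * a'))
    (hbb : d • (b * b' - b' * b) = h • (b' * b - b * b'))
    (hab : d • (a * b' - b' * a) = h • (a' * b - a * b'))
    (hba : d • (b * a' - a' * b) = h • (b' * a - b * a')) :
    (d + h) • (q * b' * (p * b)) - (d - h) • (p * b * (q * b')) =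
      h • (p * b * (p * b) + q * b' * (q * b')) := by
  have ca : a * a' = a' * a := by
    rw [← sub_eq_zero]
    apply hreg
    linear_combination (norm := module) haa
  have cb : b * b' = b' * b := by
    rw [← sub_eq_zero]
    apply hreg
    linear_combination (norm := module) hbb
  have cqa : q * a = a * q := by
    calc q * a = q * (a * a') * q := by rw [mul_assoc, mul_assoc, haq, mul_one]
      _ = a * q := by rw [ca, ← mul_assoc, hqa, one_mul]
  have cqp : q * p = p * q := by
    calc q * p = p * (a * q) * p := by rw [← mul_assoc p, hpa, one_mul]
      _ = p * q := by rw [← cqa, mul_assoc, mul_assoc, hap, mul_one]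
  obtain ⟨e, he⟩ : ∃ e, e = p * b := ⟨_, rfl⟩
  obtain ⟨e', he'⟩ : ∃ e', e' = q * b' := ⟨_, rfl⟩
  have hb : b = a * e := by rw [he, ← mul_assoc, hap, one_mul]
  have hb' : b' = a' * e' := by rw [he', ← mul_assoc, haq, one_mul]
  have h1 : d • (e' * a) = (d + h) • (a * e') - h • (a * e) := by
    have key := congrArg (q * ·) hab
    have t1 : q * (a * b') = a * e' := by rw [← mul_assoc, cqa, mul_assoc, ← he']
    have t2 : q * (b' * a) = e' * a := by rw [← mul_assoc, ← he']
    have t3 : q * (a' * b) = a * e := by rw [← mul_assoc, hqa, one_mul, hb]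
    simp only [mul_smul_comm, mul_sub, t1, t2, t3] at key
    linear_combination (norm := module) -key
  have h2 : d • (e * a') = (d - h) • (a' * e) + h • (a' * e') := by
    have key := congrArg (p * ·) hba
    have t1 : p * (b * a') = e * a' := by rw [← mul_assoc, ← he]
    have t2 : p * (a' * b) = a' * e := by
      rw [hb, ← mul_assoc a', ← ca, ← mul_assoc, ← mul_assoc, hpa, one_mul]
    have t3 : p * (b' * a) = p * a' * (e' * a) := by rw [hb']; simp only [mul_assoc]
    simp only [mul_smul_comm, mul_sub, t1, t2, t3] at key
    have key' := congrArg (p * a' * ·) h1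
    have t4 : ∀ x, p * a' * (a * x) = a' * x := fun x => by
      rw [← mul_assoc, mul_assoc p, ← ca, ← mul_assoc p, hpa, one_mul]
    simp only [mul_smul_comm, mul_sub, t4] at key'
    rw [← sub_eq_zero]
    apply hreg
    linear_combination (norm := module) d • key + h • key'
  have h3 := congrArg (fun x => p * (x * e)) h1
  have h4 := congrArg (fun x => q * (x * e')) h2
  have t3 : p * (e' * a * e) = q * (e * a' * e') := by
    rw [mul_assoc, ← hb, mul_assoc, ← hb', he, he', mul_assoc, mul_assoc, ← mul_assoc p,
      ← mul_assoc q p, cqp, cb]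
  have t4 : ∀ x, p * (a * x * e) = x * e := fun x => by
    rw [mul_assoc, ← mul_assoc, hpa, one_mul]
  have t5 : ∀ x, q * (a' * x * e') = x * e' := fun x => by
    rw [mul_assoc, ← mul_assoc, hqa, one_mul]
  simp only [smul_mul_assoc, mul_smul_comm, sub_mul, add_mul, mul_sub, mul_add, t3, t4, t5]
    at h3 h4
  rw [← he, ← he']
  linear_combination (norm := module) h4 - h3

/-- `gauss_exchange` for central elements of the ring itself. -/
theorem gauss_exchange_of_central {R : Type*} [Ring R] {d h : R}
    (hd : ∀ r, r * d = d * r) (hh : ∀ r, r * h = h * r)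
    (hreg : ∀ r : R, (d + h) * r = 0 → r = 0) {a a' b b' p q : R}
    (hap : a * p = 1) (hpa : p * a = 1) (haq : a' * q = 1) (hqa : q * a' = 1)
    (haa : d * (a * a' - a' * a) = h * (a' * a - a * a'))
    (hbb : d * (b * b' - b' * b) = h * (b' * b - b * b'))
    (hab : d * (a * b' - b' * a) = h * (a' * b - a * b'))
    (hba : d * (b * a' - a' * b) = h * (b' * a - b * a')) :
    (d + h) * (q * b' * (p * b)) - (d - h) * (p * b * (q * b')) =
      h * (p * b * (p * b) + q * b' * (q * b')) :=
  gauss_exchange (S := Subring.center R) (d := ⟨d, Subring.mem_center_iff.2 hd⟩)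
    (h := ⟨h, Subring.mem_center_iff.2 hh⟩) hreg hap hpa haq hqa haa hbb hab hba

open MulOpposite in
/-- `gauss_exchange_of_central` in the opposite ring. -/
theorem gauss_exchange_op_of_central {R : Type*} [Ring R] {d h : R}
    (hd : ∀ r, r * d = d * r) (hh : ∀ r, r * h = h * r)
    (hreg : ∀ r : R, (d + h) * r = 0 → r = 0) {a a' b b' p q : R}
    (hap : a * p = 1) (hpa : p * a = 1) (haq : a' * q = 1) (hqa : q * a' = 1)
    (haa : d * (a * a' - a' * a) = h * (a' * a - a * a'))
    (hbb : d * (b * b' - b' * b) = h * (b' * b - b * b'))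
    (hab : d * (a * b' - b' * a) = h * (b' * a - b * a'))
    (hba : d * (b * a' - a' * b) = h * (a' * b - a * b')) :
    (d + h) * (b * p * (b' * q)) - (d - h) * (b' * q * (b * p)) =
      h * (b * p * (b * p) + b' * q * (b' * q)) := by
  have hsum : ∀ r, r * (d + h) = (d + h) * r := fun r => by rw [mul_add, add_mul, hd, hh]
  have hsub : ∀ r, r * (d - h) = (d - h) * r := fun r => by rw [mul_sub, sub_mul, hd, hh]
  have key := gauss_exchange_of_central (R := Rᵐᵒᵖ) (d := op d) (h := op h)
    (a := op a) (a' := op a') (b := op b) (b' := op b') (p := op p) (q := op q)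
    (fun r => unop_injective (hd r.unop).symm) (fun r => unop_injective (hh r.unop).symm)
    (fun r hr => unop_injective <| hreg _ <| (hsum _).symm.trans (congrArg unop hr))
    (congrArg op hpa) (congrArg op hap) (congrArg op hqa) (congrArg op haq)
    (unop_injective ?_) (unop_injective ?_) (unop_injective ?_) (unop_injective ?_)
  · have := congrArg unop key
    simp only [unop_mul, unop_add, unop_sub, unop_op, hsum, hsub, hh] at this
    exact this
  all_goals simp only [unop_mul, unop_sub, unop_op, hd, hh]
  · rw [← neg_sub, mul_neg, haa, ← mul_neg, neg_sub]
  · rw [← neg_sub, mul_neg, hbb, ← mul_neg, neg_sub]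
  · rw [← neg_sub, mul_neg, hab, ← mul_neg, neg_sub]
  · rw [← neg_sub, mul_neg, hba, ← mul_neg, neg_sub]

theorem mul_single_comm_of_central {R : Type*} [Ring R] (n : ℤ) {c : R} (hc : ∀ r, r * c = c * r)
    (x : HahnSeries ℤ R) : x * HahnSeries.single n c = HahnSeries.single n c * x := by
  ext m
  obtain ⟨k, rfl⟩ : ∃ k, m = k + n := ⟨m - n, by ring⟩
  rw [HahnSeries.coeff_mul_single_add, add_comm k n, add_comm n k,
    HahnSeries.coeff_single_mul_add, hc]

theorem Uv_sub_Vv_comm (x : TT A) : x * (Uv A - Vv A) = (Uv A - Vv A) * x := by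
  rw [mul_sub, sub_mul, Uv, Vv,
    mul_single_comm_of_central 0
      (mul_single_comm_of_central (-1) fun r => by rw [mul_one, one_mul]),
    mul_single_comm_of_central (-1) fun r => by rw [mul_one, one_mul]]

theorem sc_comm {h : A} (hcen : ∀ a : A, a * h = h * a) (x : TT A) : x * sc h = sc h * x :=
  mul_single_comm_of_central 0 (mul_single_comm_of_central 0 hcen) x

theorem eq_zero_of_Uv_sub_Vv_add_sc_mul {h : A} {r : TT A}
    (hr : (Uv A - Vv A + sc h) * r = 0) : r = 0 := by
  by_contra hne
  have key : Vv A * r = (Uv A + sc h) * r := by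
    rw [← sub_eq_zero, ← neg_eq_zero, ← hr]
    simp only [add_mul, sub_mul]
    abel
  apply HahnSeries.coeff_order_eq_zero.not.2 hne
  have hc := congrArg (fun s : TT A => s.coeff (r.order + -1)) key
  have hlt : r.coeff (r.order - 1) = 0 := HahnSeries.coeff_eq_zero_of_lt_order (by omega)
  simp only [Vv, Uv, sc] at hc
  rw [HahnSeries.coeff_single_mul_add, add_mul, HahnSeries.coeff_add,
    HahnSeries.coeff_single_zero_mul, HahnSeries.coeff_single_zero_mul, one_mul,
    ← sub_eq_add_neg, hlt, mul_zero, mul_zero, add_zero] at hc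
  exact hc

/-- Relations (2.49) and (2.54):
`(u−v+h)·e(v)·e(u) − (u−v−h)·e(u)·e(v) = h·(e(u)² + e(v)²)` and
`(u−v+h)·f(u)·f(v) − (u−v−h)·f(v)·f(u) = h·(f(u)² + f(v)²)`. -/
theorem stmt15 (h : A) (hcen : ∀ a : A, a * h = h * a)
    (lgen : Fin 2 → Fin 2 → ℕ → A) (hRTT : RTT h lgen)
    (k1uinv k1vinv : TT A)
    (hk1u : k1U h lgen * k1uinv = 1 ∧ k1uinv * k1U h lgen = 1)
    (hk1v : k1V h lgen * k1vinv = 1 ∧ k1vinv * k1V h lgen = 1) :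
    ((Uv A - Vv A) + sc h) * (eV h lgen k1vinv * eU h lgen k1uinv) -
        ((Uv A - Vv A) - sc h) * (eU h lgen k1uinv * eV h lgen k1vinv) =
      sc h * (eU h lgen k1uinv * eU h lgen k1uinv + eV h lgen k1vinv * eV h lgen k1vinv) ∧
    ((Uv A - Vv A) + sc h) * (fU h lgen k1uinv * fV h lgen k1vinv) -
        ((Uv A - Vv A) - sc h) * (fV h lgen k1vinv * fU h lgen k1uinv) =
      sc h * (fU h lgen k1uinv * fU h lgen k1uinv + fV h lgen k1vinv * fV h lgen k1vinv) := by
  exact ⟨gauss_exchange_of_central Uv_sub_Vv_comm (sc_comm hcen)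
      (fun _ => eq_zero_of_Uv_sub_Vv_add_sc_mul) hk1u.1 hk1u.2 hk1v.1 hk1v.2
      (hRTT 0 0 0 0) (hRTT 0 1 0 1) (hRTT 0 0 0 1) (hRTT 0 1 0 0),
    gauss_exchange_op_of_central Uv_sub_Vv_comm (sc_comm hcen)
      (fun _ => eq_zero_of_Uv_sub_Vv_add_sc_mul) hk1u.1 hk1u.2 hk1v.1 hk1v.2
      (hRTT 0 0 0 0) (hRTT 1 0 1 0) (hRTT 0 0 1 0) (hRTT 1 0 0 0)⟩
end
end

section
/- (Part of Theorem 2.5, relation (2.76)) Under the RTT hypothesis, (u−v)·(e(u)·f(v) − f(v)·e(u)) = h·(k₂(v)·k₁(v)^{-1} − k₂(u)·k₁(u)^{-1}), as an identity in A[[u^{-1}, v^{-1}]][u, v]. -/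
noncomputable section

variable {A : Type*} [Ring A]

namespace HahnSeries

variable {R : Type*} [Ring R]

/-- The linear element `w - v`, with `v` of order `-1`, is not a left zero divisor. -/
theorem eq_zero_of_single_sub_single_neg_one_mul_eq_zero (w : R) {z : HahnSeries ℤ R}
    (hz : (single (0 : ℤ) w - single (-1 : ℤ) 1) * z = 0) : z = 0 := by
  rw [← coeff_order_eq_zero]
  have hc := congrArg (fun y : HahnSeries ℤ R => y.coeff (z.order - 1)) hz
  simp only [sub_mul, coeff_sub, coeff_single_mul, coeff_zero, one_mul, sub_zero,
    sub_neg_eq_add, sub_add_cancel] at hc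
  rwa [coeff_eq_zero_of_lt_order (show z.order - 1 < z.order by lia), mul_zero, zero_sub,
    neg_eq_zero] at hc

theorem commute_of_forall_commute_coeff {x y : HahnSeries ℤ R}
    (hxy : ∀ m n, Commute (x.coeff m) (y.coeff n)) : Commute x y := by
  ext k
  rw [coeff_mul, coeff_mul]
  refine Finset.sum_bij' (fun p _ => p.swap) (fun p _ => p.swap) ?_ ?_ ?_ ?_ ?_
  · intro p hp
    simp only [Finset.mem_antidiagonal, Prod.fst_swap, Prod.snd_swap] at hp ⊢
    exact ⟨hp.2.1, hp.1, by rw [add_comm]; exact hp.2.2⟩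
  · intro p hp
    simp only [Finset.mem_antidiagonal, Prod.fst_swap, Prod.snd_swap] at hp ⊢
    exact ⟨hp.2.1, hp.1, by rw [add_comm]; exact hp.2.2⟩
  · simp
  · simp
  · intro p _
    exact hxy _ _

/-- A series of coefficients that commute with `x` commutes with `x`. -/
theorem commute_of_forall_single_coeff {x y : HahnSeries ℤ R}
    (hxy : ∀ n, Commute x (single (0 : ℤ) (y.coeff n))) : Commute x y := by
  refine commute_of_forall_commute_coeff fun m n => ?_
  have hc := congrArg (fun z : HahnSeries ℤ R => z.coeff m) (hxy n).eq
  rwa [coeff_mul_single_zero, coeff_single_zero_mul] at hc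

theorem single_zero_inverse_eq {r : R} {y : HahnSeries ℤ R}
    (hr : single (0 : ℤ) r * y = 1 ∧ y * single (0 : ℤ) r = 1) :
    y = single (0 : ℤ) (y.coeff 0) := by
  have hc := congrArg (fun z : HahnSeries ℤ R => z.coeff 0) hr.1
  have hs : single (0 : ℤ) r * single (0 : ℤ) (y.coeff 0) = 1 := by
    rw [single_mul_single]
    rw [coeff_single_zero_mul, coeff_one, if_pos rfl] at hc
    rw [add_zero, hc]
    rfl
  exact left_inv_eq_right_inv hr.2 hs

end HahnSeries

section Yang

variable {S R : Type*} [CommRing S] [Ring R] [Module S R] [IsScalarTower S R R]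
  [SMulCommClass S R R]

theorem Commute.of_two_sided_inverse {R : Type*} [Monoid R] {s t r : R} (hst : Commute s t)
    (hr : t * r = 1 ∧ r * t = 1) : Commute s r :=
  hst.units_inv_right (u := ⟨t, r, hr.1, hr.2⟩)

/-- The quasideterminant `k₂(v)` commutes with `k₁(u)`. -/
theorem commute_quasideterminant {x h : S}
    (hx : ∀ z : R, x • z = 0 → z = 0)
    {a b c a' b' c' d' q : R} (hq : a' * q = 1 ∧ q * a' = 1)
    (haa : Commute a q)
    (hab : x • (a * b' - b' * a) = h • (a' * b - a * b'))
    (hac : x • (a * c' - c' * a) = h • (c' * a - c * a'))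
    (had : x • (a * d' - d' * a) = h • (c' * b - c * b')) :
    Commute (d' - c' * q * b') a := by
  have h₁ := congrArg (fun z => z * (q * b')) hac
  have h₂ := congrArg (fun z => c' * q * z) hab
  have e₁ (z : R) : a' * (q * z) = z := by rw [← mul_assoc, hq.1, one_mul]
  have e₂ (z : R) : q * (a' * z) = z := by rw [← mul_assoc, hq.2, one_mul]
  have e₃ (z : R) : a * (q * z) = q * (a * z) := by rw [← mul_assoc, haa.eq, mul_assoc]
  simp only [mul_sub, sub_mul, mul_assoc, smul_mul_assoc, mul_smul_comm, smul_sub, e₁, e₂, e₃]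
    at h₁ h₂ had
  refine sub_eq_zero.mp (hx _ ?_)
  simp only [mul_sub, sub_mul, mul_assoc, smul_sub]
  linear_combination (norm := module) h₁ + h₂ - had

/-- The relation between `e(u)` and `f(v)`, once the quasideterminants `k₂` are known to commute
with `k₁(u)`. -/
theorem smul_gauss_commutator_eq {x h : S}
    {a b c d a' b' c' d' p q : R} (hp : a * p = 1 ∧ p * a = 1) (hq : a' * q = 1 ∧ q * a' = 1)
    (haa : Commute a a')
    (hbc : x • (b * c' - c' * b) = h • (d' * a - d * a'))
    (hba : x • (b * a' - a' * b) = h • (b' * a - b * a'))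
    (hac : x • (a * c' - c' * a) = h • (c' * a - c * a'))
    (hk : Commute (d - c * p * b) a) (hk' : Commute (d' - c' * q * b') a) :
    x • (p * b * (c' * q) - c' * q * (p * b)) =
      h • ((d' - c' * q * a' * (q * b')) * q - (d - c * p * a * (p * b)) * p) := by
  have e₂ (z : R) : q * (a' * z) = z := by rw [← mul_assoc, hq.2, one_mul]
  have e₄ (z : R) : p * (a * z) = z := by rw [← mul_assoc, hp.2, one_mul]
  have haq : a * q = q * a := haa.of_two_sided_inverse hq
  have hpq : q * p = p * q := Commute.of_two_sided_inverse haq.symm hp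
  have hpa' : a' * p = p * a' := haa.symm.of_two_sided_inverse hp
  have e₅ (z : R) : q * (p * z) = p * (q * z) := by rw [← mul_assoc, hpq, mul_assoc]
  have e₆ (z : R) : a' * (p * z) = p * (a' * z) := by rw [← mul_assoc, hpa', mul_assoc]
  have h₁ := congrArg (fun z => p * z * q) hbc
  have h₂ := congrArg (fun z => p * c' * q * z * q) hba
  have h₃ := congrArg (fun z => p * z * p * q * b) hac
  have k := congrArg (fun z => h • z) (hk.of_two_sided_inverse hp).eq
  have k' := congrArg (fun z => h • (p * z * q)) hk'.eq
  simp only [mul_sub, sub_mul, mul_assoc, smul_mul_assoc, mul_smul_comm, smul_sub, hq.1, hq.2,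
    hp.1, hp.2, mul_one, haq, e₂, e₄, e₅, e₆] at h₁ h₂ h₃ k k' ⊢
  linear_combination (norm := module) h₁ - h₂ - h₃ + k + k'

/-- The relation between `e(u)` and `f(v)` from the Yangian relations among the entries, where
unprimed letters stand for the entries at `u` and primed ones for the entries at `v`. -/
theorem smul_gauss_commutator_eq_of_yang {x h : S}
    (hx : ∀ z : R, x • z = 0 → z = 0) (hadd : ∀ z : R, (x + h) • z = 0 → z = 0)
    (hsub : ∀ z : R, (x - h) • z = 0 → z = 0)
    {a b c d a' b' c' d' p q : R} (hp : a * p = 1 ∧ p * a = 1) (hq : a' * q = 1 ∧ q * a' = 1)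
    (raa : x • (a * a' - a' * a) = h • (a' * a - a * a'))
    (rbc : x • (b * c' - c' * b) = h • (d' * a - d * a'))
    (rba : x • (b * a' - a' * b) = h • (b' * a - b * a'))
    (rab : x • (a * b' - b' * a) = h • (a' * b - a * b'))
    (rac : x • (a * c' - c' * a) = h • (c' * a - c * a'))
    (rca : x • (c * a' - a' * c) = h • (a' * c - a * c'))
    (rad : x • (a * d' - d' * a) = h • (c' * b - c * b'))
    (rda : x • (d * a' - a' * d) = h • (b' * c - b * c'))
    (rcb : x • (c * b' - b' * c) = h • (a' * d - a * d'))
    (hspec : Commute (d - c * p * b) a' → Commute (d - c * p * b) a) :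
    x • (p * b * (c' * q) - c' * q * (p * b)) =
      h • ((d' - c' * q * a' * (q * b')) * q - (d - c * p * a * (p * b)) * p) := by
  have haa : Commute a a' := sub_eq_zero.mp <| hadd _ <| by
    linear_combination (norm := module) raa
  have hb : (b * a' - a' * b) + (a * b' - b' * a) = 0 :=
    hadd _ (by linear_combination (norm := module) rba + rab)
  have hc : (c * a' - a' * c) + (a * c' - c' * a) = 0 :=
    hadd _ (by linear_combination (norm := module) rca + rac)
  have hd : (d * a' - a' * d) + (a * d' - d' * a) = 0 := by
    refine hsub _ (hadd _ ?_)
    linear_combination (norm := module) x • (rda + rad) - h • (rcb + rbc)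
  have hk' : Commute (d' - c' * q * b') a :=
    commute_quasideterminant hx hq (haa.of_two_sided_inverse hq) rab rac rad
  have hk₀ : Commute (d - c * p * b) a' := by
    refine commute_quasideterminant (x := -x) (h := h) (b := b') (c := c') (fun z hz => hx z ?_) hp
      (haa.symm.of_two_sided_inverse hp) ?_ ?_ ?_
    · rwa [neg_smul, neg_eq_zero] at hz
    · linear_combination (norm := module) x • hb - rab
    · linear_combination (norm := module) x • hc - rac
    · linear_combination (norm := module) x • hd - rad
  exact smul_gauss_commutator_eq hp hq haa rbc rba rac (hspec hk₀) hk'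

end Yang


section Center

instance centerModule {R : Type*} [Ring R] : Module (Subring.center R) R := inferInstance

instance moduleCenterTT : Module (Subring.center (TT A)) (TT A) := centerModule

instance smulCenterTT : SMul (Subring.center (TT A)) (TT A) := moduleCenterTT.toSMul

theorem single_zero_mem_center {R : Type*} [Ring R] {r : R} (hr : r ∈ Subring.center R) :
    HahnSeries.single (0 : ℤ) r ∈ Subring.center (HahnSeries ℤ R) := by
  refine Subring.mem_center_iff.mpr fun y => HahnSeries.ext (funext fun n => ?_)
  rw [HahnSeries.coeff_mul_single_zero, HahnSeries.coeff_single_zero_mul]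
  exact Subring.mem_center_iff.mp hr _

theorem single_one_mem_center {R : Type*} [Ring R] (k : ℤ) :
    HahnSeries.single k 1 ∈ Subring.center (HahnSeries ℤ R) := by
  refine Subring.mem_center_iff.mpr fun y => HahnSeries.ext (funext fun n => ?_)
  rw [HahnSeries.coeff_mul_single, HahnSeries.coeff_single_mul, mul_one, one_mul]

variable (A) in
/-- `u - v` as a central element. -/
def uSubV : Subring.center (TT A) :=
  ⟨Uv A - Vv A, sub_mem (single_zero_mem_center (single_one_mem_center _))
    (single_one_mem_center _)⟩

/-- A central scalar as a central element of the two-variable ring. -/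
def scCenter (h : A) (hcen : ∀ a : A, a * h = h * a) : Subring.center (TT A) :=
  ⟨sc h, single_zero_mem_center (single_zero_mem_center (Subring.mem_center_iff.mpr hcen))⟩

/-- `u - v + s` is regular for every `s` independent of `v`. -/
theorem uSubV_add_smul_eq_zero (s : Subring.center (TT A)) (w : HahnSeries ℤ A)
    (hs : (s : TT A) = HahnSeries.single (0 : ℤ) w) {z : TT A}
    (hz : (uSubV A + s) • z = 0) : z = 0 := by
  refine HahnSeries.eq_zero_of_single_sub_single_neg_one_mul_eq_zero
    (HahnSeries.single (-1 : ℤ) 1 + w) ?_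
  rw [HahnSeries.single_add, ← hs, ← hz]
  change (Uv A + (s : TT A) - Vv A) * z = (Uv A - Vv A + (s : TT A)) * z
  congr 1
  abel

end Center

/-- A coefficient of `a(v)` is the same coefficient of `a(u)`. -/
theorem inV_coeff (a : ℕ → A) (n : ℤ) :
    (inV a).coeff n = HahnSeries.single (0 : ℤ) ((ofSeq a).coeff n) := by
  obtain ⟨m, rfl⟩ | hn := em (∃ m : ℕ, (m : ℤ) = n)
  · simp only [inV, ofSeq, HahnSeries.ofPowerSeries_apply_coeff, PowerSeries.coeff_mk]
  · have hn' : n ∉ Set.range (Nat.castOrderEmbedding : ℕ ↪o ℤ) := hn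
    simp only [inV, ofSeq, HahnSeries.ofPowerSeries_apply,
      HahnSeries.embDomain_of_notMem_range hn', HahnSeries.single_eq_zero]

/-- Commutation of `κ(u)` with `a(v)` specializes to `v = u`. -/
theorem commute_inU_of_commute_inV {κ : HahnSeries ℤ A} {s : ℕ → A}
    (hκ : Commute (HahnSeries.C κ) (inV s)) : Commute (HahnSeries.C κ : TT A) (inU s) := by
  refine Commute.map (HahnSeries.commute_of_forall_single_coeff fun n => ?_) HahnSeries.C
  have hn := congrArg (fun z : TT A => z.coeff n) hκ.eq
  simp only [HahnSeries.C_apply, HahnSeries.coeff_mul_single_zero,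
    HahnSeries.coeff_single_zero_mul] at hn
  rwa [inV_coeff] at hn

/-- Relation (2.76):
`(u−v)·(e(u)f(v) − f(v)e(u)) = h·(k₂(v)k₁(v)⁻¹ − k₂(u)k₁(u)⁻¹)`. -/
theorem stmt16 (h : A) (hcen : ∀ a : A, a * h = h * a)
    (lgen : Fin 2 → Fin 2 → ℕ → A) (hRTT : RTT h lgen)
    (k1uinv k1vinv : TT A)
    (hk1u : k1U h lgen * k1uinv = 1 ∧ k1uinv * k1U h lgen = 1)
    (hk1v : k1V h lgen * k1vinv = 1 ∧ k1vinv * k1V h lgen = 1) :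
    (Uv A - Vv A) *
        (eU h lgen k1uinv * fV h lgen k1vinv - fV h lgen k1vinv * eU h lgen k1uinv) =
      sc h * (k2V h lgen k1vinv * k1vinv - k2U h lgen k1uinv * k1uinv) := by
  have hx (z : TT A) (hz : uSubV A • z = 0) : z = 0 :=
    uSubV_add_smul_eq_zero 0 0 HahnSeries.single_eq_zero.symm (by rwa [add_zero])
  have hadd (z : TT A) (hz : (uSubV A + scCenter h hcen) • z = 0) : z = 0 :=
    uSubV_add_smul_eq_zero (scCenter h hcen) _ rfl hz
  have hsub (z : TT A) (hz : (uSubV A - scCenter h hcen) • z = 0) : z = 0 := by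
    refine uSubV_add_smul_eq_zero (-scCenter h hcen) (-HahnSeries.single (0 : ℤ) h) ?_
      (by rwa [← sub_eq_add_neg])
    rw [HahnSeries.single_neg]
    rfl
  have hk : inU (lcoef h lgen 1 1) - inU (lcoef h lgen 1 0) * k1uinv * inU (lcoef h lgen 0 1) =
      HahnSeries.C (ofSeq (lcoef h lgen 1 1) -
        ofSeq (lcoef h lgen 1 0) * k1uinv.coeff 0 * ofSeq (lcoef h lgen 0 1)) := by
    rw [map_sub, map_mul, map_mul, HahnSeries.C_apply (k1uinv.coeff 0),
      ← HahnSeries.single_zero_inverse_eq hk1u]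
    rfl
  exact smul_gauss_commutator_eq_of_yang hx hadd hsub hk1u hk1v (hRTT 0 0 0 0) (hRTT 0 1 1 0)
    (hRTT 0 1 0 0) (hRTT 0 0 0 1) (hRTT 0 0 1 0) (hRTT 1 0 0 0) (hRTT 0 0 1 1) (hRTT 1 1 0 0)
    (hRTT 1 0 0 1) (hk ▸ commute_inU_of_commute_inV)
end
end
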